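/- If 𝒥 is independent and P ⊆ G satisfies the Toeplitz condition, then 𝒥_P^G is independent. -/

import Mathlib

variable {G : Type*} [Group G]

/-- Left translate `g·X = {gx : x ∈ X}`. -/
def lmul (g : G) (X : Set G) : Set G := (g * ·) '' X

/-- `p⁻¹X = {y ∈ P : py ∈ X}`. -/
def presub (P : Submonoid G) (p : G) (X : Set G) : Set G := {y : G | y ∈ P ∧ p * y ∈ X}

/-- The constructible right ideals of `P`: the smallest family of subsets of `P`
containing `∅` and `P` and closed under `X ↦ pX` and `X ↦ p⁻¹X` for `p ∈ P`. -/
inductive IsConstructible (P : Submonoid G) : Set G → Prop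
  | empty : IsConstructible P ∅
  | base : IsConstructible P (P : Set G)
  | mul {p : G} (hp : p ∈ P) {X : Set G} (hX : IsConstructible P X) : IsConstructible P (lmul p X)
  | pre {p : G} (hp : p ∈ P) {X : Set G} (hX : IsConstructible P X) :
      IsConstructible P (presub P p X)

/-- `𝒥_P^G`: the smallest family of subsets of `G` containing `𝒥`, closed under left
translations by group elements and under finite intersections. -/
inductive IsConstructibleG (P : Submonoid G) : Set G → Prop
  | base {X : Set G} (hX : IsConstructible P X) : IsConstructibleG P X
  | translate (g : G) {Y : Set G} (hY : IsConstructibleG P Y) : IsConstructibleG P (lmul g Y)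
  | inter {Y₁ Y₂ : Set G} (h1 : IsConstructibleG P Y₁) (h2 : IsConstructibleG P Y₂) :
      IsConstructibleG P (Y₁ ∩ Y₂)

/-- A family of subsets (containing `∅` and closed under finite intersections) is
independent if whenever a member equals a finite union of members, it equals one of them. -/
def IsIndepFamily {α : Type*} (J : Set (Set α)) : Prop :=
  ∀ X ∈ J, ∀ n : ℕ, 0 < n → ∀ Xs : Fin n → Set α,
    (∀ i, Xs i ∈ J) → X = ⋃ i, Xs i → ∃ i, X = Xs i

/-- The Toeplitz condition for `P ⊆ G` (set-theoretic form): for every `g ∈ G` with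
`{x ∈ P : gx ∈ P} ≠ ∅` there are `p₁, q₁, …, pₙ, qₙ ∈ P` (`n ≥ 1`) with
`g = p₁⁻¹q₁⋯pₙ⁻¹qₙ` and `{x ∈ P : gx ∈ P} = qₙ⁻¹(pₙ(⋯(q₁⁻¹(p₁P))⋯))`. -/
def IsToeplitz (P : Submonoid G) : Prop :=
  ∀ g : G, {x : G | x ∈ P ∧ g * x ∈ P}.Nonempty →
    ∃ l : List (G × G), l ≠ [] ∧ (∀ pq ∈ l, pq.1 ∈ P ∧ pq.2 ∈ P) ∧
      g = (l.map fun pq => pq.1⁻¹ * pq.2).prod ∧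
      {x : G | x ∈ P ∧ g * x ∈ P} =
        l.foldl (fun S pq => presub P pq.2 (lmul pq.1 S)) (P : Set G)

/-- A `J`-valued filter. -/
def IsFilterOn {α : Type*} (J : Set (Set α)) (F : Set (Set α)) : Prop :=
  F ⊆ J ∧ (∀ X₁ ∈ F, ∀ X₂ ∈ J, X₁ ⊆ X₂ → X₂ ∈ F) ∧
    (∀ X₁ ∈ F, ∀ X₂ ∈ F, X₁ ∩ X₂ ∈ F) ∧ ∅ ∉ F

theorem mem_lmul_iff {g x : G} {X : Set G} : x ∈ lmul g X ↔ g⁻¹ * x ∈ X := by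
  constructor
  · rintro ⟨y, hy, rfl⟩
    simpa using hy
  · intro h
    exact ⟨g⁻¹ * x, h, by simp⟩

theorem lmul_lmul (g h : G) (X : Set G) : lmul g (lmul h X) = lmul (g * h) X := by
  ext x
  simp [mem_lmul_iff, mul_assoc]

theorem lmul_injective (g : G) : Function.Injective (lmul g) :=
  (mul_right_injective g).image_injective

theorem IsConstructible.subset {P : Submonoid G} {X : Set G} (hX : IsConstructible P X) :
    X ⊆ P := by
  induction hX with
  | empty => exact Set.empty_subset _
  | base => exact subset_rfl
  | mul hp _ ih =>
    rintro _ ⟨y, hy, rfl⟩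
    exact P.mul_mem hp (ih hy)
  | pre _ _ _ => exact fun _ hx => hx.1

theorem IsConstructible.inter {P : Submonoid G} {X Y : Set G} (hX : IsConstructible P X)
    (hY : IsConstructible P Y) : IsConstructible P (X ∩ Y) := by
  induction hX generalizing Y with
  | empty => simpa using IsConstructible.empty
  | base => rwa [Set.inter_eq_right.2 hY.subset]
  | @mul p hp Z hZ ih =>
    convert (ih (hY.pre hp)).mul hp using 1
    ext x
    simp only [Set.mem_inter_iff, mem_lmul_iff, presub, Set.mem_ofPred_eq, mul_inv_cancel_left]
    exact ⟨fun h => ⟨h.1, hZ.subset h.1, h.2⟩, fun h => ⟨h.1, h.2.2⟩⟩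
  | @pre p hp Z hZ ih =>
    convert (ih (hY.mul hp)).pre hp using 1
    ext x
    simp only [Set.mem_inter_iff, mem_lmul_iff, presub, Set.mem_ofPred_eq, inv_mul_cancel_left,
      and_assoc]

theorem IsConstructible.foldl {P : Submonoid G} (l : List (G × G))
    (hl : ∀ pq ∈ l, pq.1 ∈ P ∧ pq.2 ∈ P) {X : Set G} (hX : IsConstructible P X) :
    IsConstructible P (l.foldl (fun S pq => presub P pq.2 (lmul pq.1 S)) X) := by
  induction l generalizing X with
  | nil => exact hX
  | cons a l ih =>
    have ha := hl a (by simp)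
    exact ih (fun pq h => hl pq (by simp [h])) ((hX.mul ha.1).pre ha.2)

/-- Under the Toeplitz condition `P ∩ g·P` is constructible for every `g ∈ G`. -/
theorem IsToeplitz.isConstructible_inter_lmul_self {P : Submonoid G} (hT : IsToeplitz P) (g : G) :
    IsConstructible P ((P : Set G) ∩ lmul g P) := by
  have hset : (P : Set G) ∩ lmul g P = {x : G | x ∈ P ∧ g⁻¹ * x ∈ P} := by
    ext x
    simp [mem_lmul_iff]
  rw [hset]
  rcases Set.eq_empty_or_nonempty {x : G | x ∈ P ∧ g⁻¹ * x ∈ P} with h | h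
  · rw [h]
    exact .empty
  · obtain ⟨l, -, hl, -, hfold⟩ := hT g⁻¹ h
    rw [hfold]
    exact .foldl l hl .base

theorem IsConstructible.inter_lmul {P : Submonoid G} (hT : IsToeplitz P) {X : Set G}
    (hX : IsConstructible P X) (g : G) : IsConstructible P ((P : Set G) ∩ lmul g X) := by
  induction hX generalizing g with
  | empty => simpa [lmul] using IsConstructible.empty
  | base => exact hT.isConstructible_inter_lmul_self g
  | mul _ _ ih =>
    rw [lmul_lmul]
    exact ih _
  | @pre p _ Z _ ih =>
    convert (hT.isConstructible_inter_lmul_self g).inter (ih (g * p⁻¹)) using 1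
    ext x
    simp only [Set.mem_inter_iff, mem_lmul_iff, presub, Set.mem_ofPred_eq, SetLike.mem_coe,
      mul_inv_rev, inv_inv, mul_assoc]
    tauto

theorem IsConstructibleG.inter_lmul {P : Submonoid G} (hT : IsToeplitz P) {Y : Set G}
    (hY : IsConstructibleG P Y) (g : G) : IsConstructible P ((P : Set G) ∩ lmul g Y) := by
  induction hY generalizing g with
  | base hX => exact hX.inter_lmul hT g
  | translate h _ ih =>
    rw [lmul_lmul]
    exact ih _
  | inter _ _ ih₁ ih₂ =>
    convert (ih₁ g).inter (ih₂ g) using 1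
    ext x
    simp only [Set.mem_inter_iff, mem_lmul_iff]
    tauto

theorem IsConstructibleG.exists_lmul_subset {P : Submonoid G} {Y : Set G}
    (hY : IsConstructibleG P Y) : ∃ g : G, lmul g Y ⊆ P := by
  induction hY with
  | base hX => exact ⟨1, by simpa [lmul] using hX.subset⟩
  | translate h _ ih =>
    obtain ⟨g, hg⟩ := ih
    exact ⟨g * h⁻¹, by simpa [lmul_lmul] using hg⟩
  | inter _ _ ih₁ _ =>
    obtain ⟨g, hg⟩ := ih₁
    exact ⟨g, (Set.image_mono Set.inter_subset_left).trans hg⟩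

/-- If `𝒥` is independent and `P ⊆ G` satisfies the Toeplitz condition, then `𝒥_P^G`
is independent. -/
theorem stmt_7 (P : Submonoid G) (hind : IsIndepFamily {X : Set G | IsConstructible P X})
    (hT : IsToeplitz P) : IsIndepFamily {Y : Set G | IsConstructibleG P Y} := by
  intro X hX n hn Xs hXs hUnion
  obtain ⟨g, hg⟩ := IsConstructibleG.exists_lmul_subset hX
  have key : ∀ Y, IsConstructibleG P Y → Y ⊆ X → IsConstructible P (lmul g Y) := by
    intro Y hY hYX
    have h := hY.inter_lmul hT g
    have hsub : lmul g Y ⊆ P := (Set.image_mono hYX).trans hg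
    rwa [Set.inter_eq_right.2 hsub] at h
  obtain ⟨i, hi⟩ := hind (lmul g X) (key X hX subset_rfl) n hn (fun i => lmul g (Xs i))
    (fun i => key _ (hXs i) (hUnion ▸ Set.subset_iUnion Xs i))
    (by rw [hUnion]; exact Set.image_iUnion)
  exact ⟨i, lmul_injective g hi⟩
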